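/- Let (Θ,𝒜) and (Y,𝒴) be measurable spaces with 𝒴 countably generated, ν a Markov kernel from (Θ,𝒜) to (Y,𝒴), μ a prior probability measure on (Θ,𝒜), and Π the joint probability on Θ × Y^ℕ given by Π(A×E) = ∫_A (ν^θ)^{⊗ℕ}(E) μ(dθ). Let 𝒜* be the sub-σ-field of 𝒜 generated by the functions θ ↦ ν^θ(E), E ∈ 𝒴. Then 𝒜* (the minimal sufficient σ-field of the i.i.d. model) is exactly estimable: for every bounded 𝒜*-measurable a : Θ → ℝ there exists a bounded measurable t : Y^ℕ → ℝ such that a(θ) = t(x) for Π-almost every (θ,x). -/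

import Mathlib

open MeasureTheory ProbabilityTheory
open scoped ENNReal NNReal

/-- The minimal sufficient σ-field: the sub-σ-field of the parameter space generated by
the functions `θ ↦ ν θ E` for measurable `E`. -/
noncomputable def minimalSufficient {Θ Y : Type*} [mΘ : MeasurableSpace Θ]
    [mY : MeasurableSpace Y] (ν : Kernel Θ Y) : MeasurableSpace Θ :=
  ⨆ E ∈ {E : Set Y | MeasurableSet E},
    MeasurableSpace.comap (fun θ => ν θ E) (inferInstance : MeasurableSpace ℝ≥0∞)

/-- The i.i.d. product measure depends measurably on the parameter. -/
lemma iidKernel_measurable {Θ Y : Type*} [MeasurableSpace Θ] [MeasurableSpace Y]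
    (ν : Kernel Θ Y) [IsMarkovKernel ν] :
    Measurable (fun θ => Measure.infinitePi (fun _ : ℕ => ν θ)) := by
  refine Measurable.measure_of_isPiSystem_of_isProbabilityMeasure
    (generateFrom_squareCylinders (α := fun _ : ℕ => Y)).symm
    (isPiSystem_squareCylinders (fun _ => MeasurableSpace.isPiSystem_measurableSet) (by simp)) ?_
  rintro _ ⟨s, t, ht, rfl⟩
  have ht' : ∀ i, MeasurableSet (t i) := fun i => ht i (Set.mem_univ i)
  have : (fun θ => Measure.infinitePi (fun _ : ℕ => ν θ) ((s : Set ℕ).pi t))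
      = fun θ => ∏ i ∈ s, ν θ (t i) := by
    ext θ
    exact Measure.infinitePi_pi _ (fun i _ => ht' i)
  rw [this]
  exact Finset.measurable_prod _ (fun i _ => Kernel.measurable_coe ν (ht' i))

/-- The i.i.d. product kernel. -/
noncomputable def iidKernel {Θ Y : Type*} [MeasurableSpace Θ] [MeasurableSpace Y]
    (ν : Kernel Θ Y) [IsMarkovKernel ν] : Kernel Θ (ℕ → Y) where
  toFun θ := Measure.infinitePi (fun _ : ℕ => ν θ)
  measurable' := iidKernel_measurable ν

lemma iidKernel_apply {Θ Y : Type*} [MeasurableSpace Θ] [MeasurableSpace Y]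
    (ν : Kernel Θ Y) [IsMarkovKernel ν] (θ : Θ) :
    iidKernel ν θ = Measure.infinitePi (fun _ : ℕ => ν θ) := rfl

instance iidKernel_markov {Θ Y : Type*} [MeasurableSpace Θ] [MeasurableSpace Y]
    (ν : Kernel Θ Y) [IsMarkovKernel ν] : IsMarkovKernel (iidKernel ν) :=
  ⟨fun θ => by rw [iidKernel_apply]; infer_instance⟩

/-- The cylinder formula characterizes the joint law. -/
lemma joint_eq_compProd {Θ Y : Type*} [MeasurableSpace Θ] [MeasurableSpace Y]
    (ν : Kernel Θ Y) [IsMarkovKernel ν]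
    (μ : Measure Θ) [IsProbabilityMeasure μ]
    (Pr : Measure (Θ × (ℕ → Y))) [IsProbabilityMeasure Pr]
    (hPr : ∀ A : Set Θ, MeasurableSet A → ∀ (s : Finset ℕ) (E : ℕ → Set Y),
      (∀ i ∈ s, MeasurableSet (E i)) →
      Pr (A ×ˢ {x : ℕ → Y | ∀ i ∈ s, x i ∈ E i})
        = ∫⁻ θ in A, ∏ i ∈ s, ν θ (E i) ∂μ) :
    Pr = μ ⊗ₘ iidKernel ν := by
  have key : ∀ A : Set Θ, MeasurableSet A → ∀ (s : Finset ℕ) (t : ℕ → Set Y),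
      (∀ i, MeasurableSet (t i)) →
      Pr (A ×ˢ ((s : Set ℕ).pi t)) = (μ ⊗ₘ iidKernel ν) (A ×ˢ ((s : Set ℕ).pi t)) := by
    intro A hA s t ht
    rw [Measure.compProd_apply_prod hA (MeasurableSet.pi s.countable_toSet (fun i _ => ht i))]
    have h1 := hPr A hA s t (fun i _ => ht i)
    have h2 : {x : ℕ → Y | ∀ i ∈ s, x i ∈ t i} = (s : Set ℕ).pi t := by
      ext x; simp
    rw [h2] at h1
    rw [h1]
    refine lintegral_congr fun θ => ?_
    rw [iidKernel_apply]
    exact (Measure.infinitePi_pi _ (fun i _ => ht i)).symm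
  refine Measure.ext_prod fun {A T} hA hT => ?_
  have hAu : MeasurableSet (A ×ˢ (Set.univ : Set (ℕ → Y))) := hA.prod .univ
  have tr : ∀ (M : Measure (Θ × (ℕ → Y))) (T : Set (ℕ → Y)), MeasurableSet T →
      (M.restrict (A ×ˢ (Set.univ : Set (ℕ → Y)))).map Prod.snd T = M (A ×ˢ T) := by
    intro M T hT
    rw [Measure.map_apply measurable_snd hT, Measure.restrict_apply (measurable_snd hT)]
    congr 1
    ext p; simp [and_comm]
  rw [← tr _ T hT, ← tr _ T hT]
  congr 1
  refine ext_of_generate_finite _ (generateFrom_squareCylinders (α := fun _ : ℕ => Y)).symm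
    (isPiSystem_squareCylinders (fun _ => MeasurableSpace.isPiSystem_measurableSet) (by simp)) ?_ ?_
  · rintro _ ⟨s, t, ht, rfl⟩
    have ht' : ∀ i, MeasurableSet (t i) := fun i => ht i (Set.mem_univ i)
    have hm : MeasurableSet ((s : Set ℕ).pi t) :=
      MeasurableSet.pi s.countable_toSet (fun i _ => ht' i)
    rw [tr _ _ hm, tr _ _ hm]
    exact key A hA s t ht'
  · rw [tr _ _ .univ, tr _ _ .univ]
    have := key A hA ∅ (fun _ => Set.univ) (fun _ => .univ)
    simpa using this

/-- Strong law of large numbers for empirical frequencies under the i.i.d. product. -/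
lemma empirical_tendsto {Y : Type*} [MeasurableSpace Y] (P : Measure Y) [IsProbabilityMeasure P]
    (E : Set Y) (hE : MeasurableSet E) :
    ∀ᵐ x ∂(Measure.infinitePi (fun _ : ℕ => P)),
      Filter.Tendsto (fun n : ℕ => (∑ i ∈ Finset.range n, E.indicator (1 : Y → ℝ) (x i)) / n)
        Filter.atTop (nhds (P E).toReal) := by
  have hm : Measurable (E.indicator (1 : Y → ℝ)) := measurable_one.indicator hE
  have hmp : ∀ i : ℕ, MeasurePreserving (Function.eval i)
      (Measure.infinitePi (fun _ : ℕ => P)) P :=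
    fun i => measurePreserving_eval_infinitePi (fun _ : ℕ => P) i
  have hint0 : Integrable (E.indicator (1 : Y → ℝ)) P :=
    (integrable_const (1 : ℝ)).indicator hE
  have hind : iIndepFun (fun (i : ℕ) (x : ℕ → Y) => E.indicator (1 : Y → ℝ) (x i))
      (Measure.infinitePi (fun _ : ℕ => P)) :=
    iIndepFun_infinitePi (P := fun _ : ℕ => P) (X := fun _ => E.indicator (1 : Y → ℝ))
      (fun _ => hm)
  have h := strong_law_ae_real (μ := Measure.infinitePi (fun _ : ℕ => P))
    (fun i x => E.indicator (1 : Y → ℝ) (x i))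
    ((hmp 0).integrable_comp_of_integrable hint0)
    (fun i j hij => hind.indepFun hij)
    (fun i => ⟨(hm.comp (measurable_pi_apply i)).aemeasurable,
      (hm.comp (measurable_pi_apply 0)).aemeasurable, by
        have e : ∀ i : ℕ, Measure.map (fun x : ℕ → Y => E.indicator (1 : Y → ℝ) (x i))
            (Measure.infinitePi (fun _ : ℕ => P)) = P.map (E.indicator (1 : Y → ℝ)) := by
          intro i
          have e1 := Measure.map_map (μ := Measure.infinitePi (fun _ : ℕ => P)) hm
            (hmp i).measurable
          rw [(hmp i).map_eq] at e1
          exact e1.symm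
        rw [e i, e 0]⟩)
  have hI : ∫ x, E.indicator (1 : Y → ℝ) (x 0) ∂(Measure.infinitePi (fun _ : ℕ => P))
      = (P E).toReal := by
    have h1 : ∫ y, E.indicator (1 : Y → ℝ) y ∂P = (P E).toReal := by
      rw [integral_indicator_one hE]; rfl
    rw [← h1, ← (hmp 0).map_eq, integral_map (hmp 0).measurable.aemeasurable
      (by rw [(hmp 0).map_eq]; exact hm.aestronglyMeasurable), (hmp 0).map_eq]
  rw [hI] at h
  exact h

/-- A real function whose preimages are a.e. equal to preimages of measurable sets under
`Prod.snd` is a.e. equal to a measurable function of the second coordinate. -/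
lemma exists_measurable_snd {Θ X : Type*} [MeasurableSpace Θ] [MeasurableSpace X]
    (Pr : Measure (Θ × X)) (a : Θ → ℝ)
    (h : ∀ q : ℚ, ∃ T : Set X, MeasurableSet T ∧
      ∀ᵐ p ∂Pr, (a p.1 < q ↔ p.2 ∈ T)) :
    ∃ t : X → ℝ, Measurable t ∧ ∀ᵐ p ∂Pr, a p.1 = t p.2 := by
  classical
  choose T hT hT' using h
  refine ⟨fun x => (⨅ q : ℚ, if x ∈ T q then (((q : ℝ) : EReal)) else ⊤).toReal, ?_, ?_⟩
  · refine Measurable.ereal_toReal (Measurable.iInf fun q => ?_)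
    exact Measurable.ite (hT q) measurable_const measurable_const
  · filter_upwards [ae_all_iff.2 hT'] with p hp
    have : (⨅ q : ℚ, if p.2 ∈ T q then (((q : ℝ) : EReal)) else ⊤) = (a p.1 : EReal) := by
      apply le_antisymm
      · refine le_of_forall_gt fun c hc => ?_
        obtain ⟨q, hq1, hq2⟩ := EReal.lt_iff_exists_rat_btwn.1 hc
        have hq1' : a p.1 < q := by exact_mod_cast hq1
        refine lt_of_le_of_lt (iInf_le _ q) ?_
        rw [if_pos ((hp q).1 hq1')]
        exact hq2
      · refine le_iInf fun q => ?_
        split_ifs with hq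
        · exact_mod_cast ((hp q).2 hq).le
        · exact le_top
    rw [this, EReal.toReal_coe]

/-- In an i.i.d. Bayesian model (joint law `Pr` on `Θ × Y^ℕ` characterized by the cylinder
formula `hPr`, with `𝒴` countably generated), the minimal sufficient σ-field is exactly
estimable: every bounded function of `θ` measurable w.r.t. it coincides `Pr`-a.s. with a
bounded measurable function of the infinite sample. -/
theorem minimalSufficient_exactlyEstimable_of_iid
    {Θ Y : Type*} [mΘ : MeasurableSpace Θ] [mY : MeasurableSpace Y]
    [MeasurableSpace.CountablyGenerated Y]
    (ν : Kernel Θ Y) [IsMarkovKernel ν]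
    (μ : Measure Θ) [IsProbabilityMeasure μ]
    (Pr : Measure (Θ × (ℕ → Y))) [IsProbabilityMeasure Pr]
    (hPr : ∀ A : Set Θ, MeasurableSet A → ∀ (s : Finset ℕ) (E : ℕ → Set Y),
      (∀ i ∈ s, MeasurableSet (E i)) →
      Pr (A ×ˢ {x : ℕ → Y | ∀ i ∈ s, x i ∈ E i})
        = ∫⁻ θ in A, ∏ i ∈ s, ν θ (E i) ∂μ) :
    ∀ a : Θ → ℝ, Measurable[minimalSufficient ν] a → (∃ C : ℝ, ∀ θ, |a θ| ≤ C) →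
      ∃ t : (ℕ → Y) → ℝ, Measurable t ∧ (∃ C : ℝ, ∀ x, |t x| ≤ C) ∧
        (fun p : Θ × (ℕ → Y) => a p.1) =ᵐ[Pr] (fun p : Θ × (ℕ → Y) => t p.2) := by
  intro a ha ⟨C, hC⟩
  have hj := joint_eq_compProd ν μ Pr hPr
  have hle : minimalSufficient ν ≤ MeasurableSpace.map Prod.fst
      (eventuallyMeasurableSpace
        (MeasurableSpace.comap (Prod.snd : Θ × (ℕ → Y) → (ℕ → Y)) inferInstance) (ae Pr)) := by
    unfold minimalSufficient
    refine iSup₂_le fun E hE => ?_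
    have hE' : MeasurableSet E := hE
    rintro _ ⟨S, hS, rfl⟩
    let f : ℕ → (ℕ → Y) → ℝ :=
      fun n x => (∑ i ∈ Finset.range n, E.indicator (1 : Y → ℝ) (x i)) / n
    have hf : ∀ n, Measurable (f n) := fun n =>
      (Finset.measurable_sum _ fun i _ =>
        ((measurable_one.indicator hE').comp (measurable_pi_apply i))).div_const _
    have hae : ∀ᵐ p ∂Pr, Filter.Tendsto (fun n => f n p.2 - (ν p.1 E).toReal)
        Filter.atTop (nhds 0) := by
      rw [hj]
      refine Measure.ae_compProd_of_ae_ae ?_ ?_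
      · refine measurableSet_tendsto _ fun n => ?_
        exact ((hf n).comp measurable_snd).sub
          (((Kernel.measurable_coe ν hE').comp measurable_fst).ennreal_toReal)
      · refine Filter.Eventually.of_forall fun θ => ?_
        rw [iidKernel_apply]
        filter_upwards [empirical_tendsto (ν θ) E hE'] with x hx
        simpa using hx.sub_const (ν θ E).toReal
    let g : (ℕ → Y) → ℝ≥0∞ :=
      fun x => ENNReal.ofReal (Filter.limsup (fun n => f n x) Filter.atTop)
    have hg : Measurable g := (Measurable.limsup hf).ennreal_ofReal
    refine ⟨Prod.snd ⁻¹' (g ⁻¹' S), ⟨g ⁻¹' S, hg hS, rfl⟩, ?_⟩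
    filter_upwards [hae] with p hp
    have h2 : Filter.Tendsto (fun n => f n p.2) Filter.atTop (nhds (ν p.1 E).toReal) := by
      simpa using hp.add_const (ν p.1 E).toReal
    have h3 : g p.2 = ν p.1 E := by
      change ENNReal.ofReal _ = _
      rw [h2.limsup_eq, ENNReal.ofReal_toReal (measure_ne_top _ _)]
    apply propext
    change ν p.1 E ∈ S ↔ g p.2 ∈ S
    rw [h3]
  obtain ⟨t, ht, hat⟩ := exists_measurable_snd Pr a (fun q => by
    obtain ⟨_, ⟨T, hT, rfl⟩, h⟩ := hle _ (ha (measurableSet_Iio (a := (q : ℝ))))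
    refine ⟨T, hT, ?_⟩
    filter_upwards [h] with p hp
    exact iff_of_eq hp)
  refine ⟨fun x => max (-C) (min C (t x)), measurable_const.max (measurable_const.min ht),
    ⟨|C|, fun x => ?_⟩, ?_⟩
  · rw [abs_le]
    have h1 := neg_abs_le C
    have h2 := le_abs_self C
    have h3 := neg_le_abs C
    exact ⟨le_trans (by linarith) (le_max_left _ _), max_le h3 ((min_le_left _ _).trans h2)⟩
  · filter_upwards [hat] with p hp
    have := abs_le.1 (hC p.1)
    change a p.1 = max (-C) (min C (t p.2))
    rw [← hp, min_eq_right this.2, max_eq_right this.1]
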